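/- Let φ : D → ℂ be holomorphic and define y : D → ℂ^k by y_α(z) = k^{1−α} · z^{(k+1)/2 − α} · (L^{α−1} φ)(z) for α = 1, …, k. Then y satisfies the linear system y′(z) = (Û(t) + μ̂/z)·y(z) for all z ∈ D if and only if φ satisfies the generalized hypergeometric equation (L^k φ)(z) = (k z)^k e^t φ(z) for all z ∈ D. -/

import Mathlib

open Complex

/-- The Euler operator `(L f)(z) = z·f′(z)`. -/
noncomputable def eulerOp : (ℂ → ℂ) → (ℂ → ℂ) := fun f z => z * deriv f z

/-- The matrix `Û(t)`: `Û_{α,α+1} = k` for `1 ≤ α ≤ k-1`, `Û_{k,1} = k·e^t`, all other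
entries `0` (1-based indexing). -/
noncomputable def UhatMat (k : ℕ) (t : ℂ) : Matrix (Fin k) (Fin k) ℂ :=
  Matrix.of fun a b =>
    if b.val = a.val + 1 then (k : ℂ)
    else if a.val = k - 1 ∧ b.val = 0 then (k : ℂ) * Complex.exp t
    else 0

/-- The diagonal matrix `μ̂` with `μ̂_{αα} = (k+1)/2 - α` (1-based indexing). -/
noncomputable def muHatMat (k : ℕ) : Matrix (Fin k) (Fin k) ℂ :=
  Matrix.diagonal fun a => ((k : ℂ) + 1) / 2 - ((a.val : ℂ) + 1)

theorem DifferentiableOn.eulerOp {f : ℂ → ℂ} {s : Set ℂ} (hs : IsOpen s)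
    (hf : DifferentiableOn ℂ f s) : DifferentiableOn ℂ (eulerOp f) s :=
  differentiableOn_id.mul (hf.deriv hs)

theorem DifferentiableOn.eulerOp_iterate {f : ℂ → ℂ} {s : Set ℂ} (hs : IsOpen s)
    (hf : DifferentiableOn ℂ f s) (n : ℕ) : DifferentiableOn ℂ (_root_.eulerOp^[n] f) s := by
  induction n with
  | zero => exact hf
  | succ n ih =>
    rw [Function.iterate_succ_apply']
    exact ih.eulerOp hs

/-- Derivative of a power times a function, expressed through the Euler operator. -/
theorem deriv_const_mul_cpow_mul {f : ℂ → ℂ} {z : ℂ} (hz : z ∈ slitPlane)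
    (hf : DifferentiableAt ℂ f z) (A c : ℂ) :
    deriv (fun w => A * w ^ c * f w) z
      = A * z ^ (c - 1) * eulerOp f z + c / z * (A * z ^ c * f z) := by
  have hz0 : z ≠ 0 := slitPlane_ne_zero hz
  have h := (((hasDerivAt_id z).cpow_const (c := c) hz).const_mul A).mul hf.hasDerivAt
  refine h.deriv.trans ?_
  simp only [eulerOp, id, cpow_sub _ _ hz0, cpow_one]
  field_simp
  ring

/-- Action of `μ̂/z` on a vector. -/
theorem sum_muHatMat {k : ℕ} (z : ℂ) (v : ℕ → ℂ) (a : Fin k) :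
    ∑ b : Fin k, muHatMat k a b / z * v b.val
      = (((k : ℂ) + 1) / 2 - ((a.val : ℂ) + 1)) / z * v a.val := by
  rw [Finset.sum_eq_single a]
  · simp [muHatMat]
  · intro b _ hb
    simp [muHatMat, Matrix.diagonal_apply_ne' _ hb]
  · simp

/-- Action of `Û(t) + μ̂/z` on a vector, in a row other than the last. -/
theorem sum_UhatMat_add_muHatMat_of_lt {k : ℕ} (t z : ℂ) (v : ℕ → ℂ) (a : Fin k)
    (ha : a.val + 1 < k) :
    ∑ b : Fin k, (UhatMat k t a b + muHatMat k a b / z) * v b.val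
      = k * v (a.val + 1) + (((k : ℂ) + 1) / 2 - ((a.val : ℂ) + 1)) / z * v a.val := by
  simp only [add_mul, Finset.sum_add_distrib]
  congr 1
  · rw [Finset.sum_eq_single ⟨a.val + 1, ha⟩]
    · simp [UhatMat]
    · intro b _ hb
      have h₁ : b.val ≠ a.val + 1 := fun h => hb (Fin.ext h)
      have h₂ : a.val ≠ k - 1 := by omega
      simp [UhatMat, h₁, h₂]
    · simp
  · exact sum_muHatMat z v a

/-- Action of `Û(t) + μ̂/z` on a vector, in the last row. -/
theorem sum_UhatMat_add_muHatMat_of_eq {k : ℕ} (t z : ℂ) (v : ℕ → ℂ) (a : Fin k)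
    (ha : a.val + 1 = k) :
    ∑ b : Fin k, (UhatMat k t a b + muHatMat k a b / z) * v b.val
      = k * exp t * v 0 + (((k : ℂ) + 1) / 2 - ((a.val : ℂ) + 1)) / z * v a.val := by
  have ha' : a.val = k - 1 := by omega
  simp only [add_mul, Finset.sum_add_distrib]
  congr 1
  · rw [Finset.sum_eq_single ⟨0, by omega⟩]
    · simp [UhatMat, ← ha']
    · intro b _ hb
      have h₁ : b.val ≠ a.val + 1 := by have := b.isLt; omega
      have h₂ : b.val ≠ 0 := fun h => hb (Fin.ext h)
      simp [UhatMat, h₁, h₂]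
    · simp
  · exact sum_muHatMat z v a

/-- **Lemma 1 of the paper.** For `φ` holomorphic on the slit plane, the vector
`y_α(z) = k^{1-α}·z^{(k+1)/2-α}·(L^{α-1}φ)(z)` solves the system
`y′ = (Û(t) + μ̂/z)·y` on the slit plane if and only if `φ` solves the generalized
hypergeometric equation `(z d/dz)^k φ = (kz)^k e^t φ` there. -/
theorem system_iff_hypergeometric (k : ℕ) (hk : 1 ≤ k) (t : ℂ) (φ : ℂ → ℂ)
    (hφ : DifferentiableOn ℂ φ Complex.slitPlane) :
    (∀ z ∈ Complex.slitPlane, ∀ a : Fin k,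
        deriv (fun w : ℂ =>
            ((k : ℂ) ^ a.val)⁻¹ * w ^ (((k : ℂ) + 1) / 2 - ((a.val : ℂ) + 1)) *
              (eulerOp^[a.val] φ) w) z
          = ∑ b : Fin k, (UhatMat k t a b + muHatMat k a b / z) *
              (((k : ℂ) ^ b.val)⁻¹ * z ^ (((k : ℂ) + 1) / 2 - ((b.val : ℂ) + 1)) *
                (eulerOp^[b.val] φ) z))
      ↔ (∀ z ∈ Complex.slitPlane,
          (eulerOp^[k] φ) z = ((k : ℂ) * z) ^ k * Complex.exp t * φ z) := by
  have hk0 : (k : ℂ) ≠ 0 := by exact_mod_cast (by omega : k ≠ 0)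
  have hderiv (z : ℂ) (hz : z ∈ slitPlane) (n : ℕ) (A c : ℂ) :
      deriv (fun w => A * w ^ c * (eulerOp^[n] φ) w) z = A * z ^ (c - 1) * (eulerOp^[n + 1] φ) z
        + c / z * (A * z ^ c * (eulerOp^[n] φ) z) := by
    rw [Function.iterate_succ_apply']
    exact deriv_const_mul_cpow_mul hz ((hφ.eulerOp_iterate isOpen_slitPlane n).differentiableAt
      (isOpen_slitPlane.mem_nhds hz)) A c
  let y (z : ℂ) (n : ℕ) : ℂ :=
    ((k : ℂ) ^ n)⁻¹ * z ^ (((k : ℂ) + 1) / 2 - ((n : ℂ) + 1)) * (eulerOp^[n] φ) z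
  refine forall₂_congr fun z hz => ?_
  have hz0 : z ≠ 0 := slitPlane_ne_zero hz
  -- Only the last row of the system carries information.
  have hlast (a : Fin k) (ha : a.val + 1 = k) :
      ((k : ℂ) ^ a.val)⁻¹ * z ^ (((k : ℂ) + 1) / 2 - ((a.val : ℂ) + 1) - 1) *
          (eulerOp^[a.val + 1] φ) z = k * exp t * y z 0 ↔
        (eulerOp^[k] φ) z = ((k : ℂ) * z) ^ k * exp t * φ z := by
    have hpow : z ^ (((k : ℂ) + 1) / 2 - (((0 : ℕ) : ℂ) + 1)) =
        z ^ (((k : ℂ) + 1) / 2 - ((a.val : ℂ) + 1) - 1) * z ^ k := by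
      rw [← cpow_natCast, ← cpow_add _ _ hz0]
      congr 1
      have : (k : ℂ) = a.val + 1 := by exact_mod_cast ha.symm
      rw [this]
      push_cast
      ring
    have hP : z ^ (((k : ℂ) + 1) / 2 - ((a.val : ℂ) + 1) - 1) ≠ 0 := by simp [cpow_eq_zero_iff, hz0]
    have hkk : (k : ℂ) ^ k = k ^ a.val * k := by rw [← pow_succ, ha]
    simp only [y, hpow, ha, mul_pow, hkk, pow_zero, inv_one, one_mul, Function.iterate_zero, id]
    generalize z ^ (((k : ℂ) + 1) / 2 - ((a.val : ℂ) + 1) - 1) = P at hP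
    rw [mul_assoc, inv_mul_eq_iff_eq_mul₀ (pow_ne_zero _ hk0), ← mul_right_inj' hP (c := _ * φ z)]
    exact Eq.congr_right (by ring)
  constructor
  · intro h
    have ha : (⟨k - 1, by omega⟩ : Fin k).val + 1 = k := Nat.sub_add_cancel hk
    have h' := h ⟨k - 1, by omega⟩
    rw [hderiv z hz, sum_UhatMat_add_muHatMat_of_eq t z (y z) _ ha] at h'
    exact (hlast _ ha).1 (add_right_cancel h')
  · intro h a
    rw [hderiv z hz]
    rcases Nat.lt_or_eq_of_le (Nat.succ_le_of_lt a.isLt) with ha | ha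
    · rw [sum_UhatMat_add_muHatMat_of_lt t z (y z) a ha]
      refine congrArg (· + _) ?_
      have he : ((k : ℂ) + 1) / 2 - (((a.val + 1 : ℕ) : ℂ) + 1) =
          ((k : ℂ) + 1) / 2 - ((a.val : ℂ) + 1) - 1 := by push_cast; ring
      simp only [y, he, pow_succ]
      field_simp
    · rw [sum_UhatMat_add_muHatMat_of_eq t z (y z) a ha]
      exact congrArg (· + _) ((hlast a ha).2 h)
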